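/- For all integers m, n, t > 0 and all integers a, b with 0 ≤ b ≤ a ≤ n−t and n−b−1 ≠ 0, the number of m-divisible positive (m,t)-Schröder paths S of height n with dg(S) = a and cd(S) = b equals ( (t+a)/n − (a−b)/(n−b−1) ) · C(n−b−1, a−b)·C(mn+n−t−a−1, n−t−a), as an identity in ℚ. -/

import Mathlib

/-- A step of a lattice path: north `(0,1)`, east `(1,0)` or diagonal `(1,1)`. -/
inductive Step : Type
  | N : Step
  | E : Step
  | D : Step
  deriving DecidableEq

/-- The displacement vector of a step. -/
def stepVec : Step → ℤ × ℤ
  | .N => (0, 1)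
  | .E => (1, 0)
  | .D => (1, 1)

/-- The lattice point reached after the first `k` steps of the path `P` (starting at the
origin). -/
def pt (P : List Step) (k : ℕ) : ℤ × ℤ := ((P.take k).map stepVec).sum

/-- The path `P` starts with at least `t` north steps. -/
def StartsNorth (t : ℤ) (P : List Step) : Prop := List.replicate t.toNat Step.N <+: P

/-- The path `P` stays weakly above the line `x = m·y`. -/
def AboveLine (m : ℤ) (P : List Step) : Prop := ∀ k : ℕ, (pt P k).1 ≤ m * (pt P k).2

/-- An `(m,t)`-Schröder path of height `n`: a lattice path from `(0,0)` to `(mn,n)` using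
north, east and diagonal steps, starting with at least `t` north steps and never going
below the line `x = m·y`. -/
def IsSchroeder (m n t : ℤ) (P : List Step) : Prop :=
  StartsNorth t P ∧ pt P P.length = (m * n, n) ∧ AboveLine m P

/-- An `(m,t)`-Dyck path of height `n`: an `(m,t)`-Schröder path of height `n` with no
diagonal steps. -/
def IsDyck (m n t : ℤ) (P : List Step) : Prop :=
  IsSchroeder m n t P ∧ ∀ s ∈ P, s ≠ Step.D

/-- A Schröder path is small if none of its diagonal steps starts on the line `x = m·y`. -/
def IsSmall (m : ℤ) (P : List Step) : Prop :=
  ∀ j : ℕ, P[j]? = some Step.D → (pt P j).1 ≠ m * (pt P j).2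

/-- A Schröder path is positive if it touches the line `x = m·y` only at its two
endpoints. -/
def IsPositive (m : ℤ) (P : List Step) : Prop :=
  ∀ k : ℕ, 0 < k → k < P.length → (pt P k).1 ≠ m * (pt P k).2

/-- The set of indices `j` such that the `j`-th step of `P` is east and the `(j+1)`-st is
north; the corresponding valley point is `pt P (j+1)`. -/
def valleys (P : List Step) : Finset ℕ :=
  (Finset.range P.length).filter fun j => P[j]? = some Step.E ∧ P[j + 1]? = some Step.N

/-- The number of valleys of `P`. -/
def val (P : List Step) : ℕ := (valleys P).card

/-- The number of valleys of `P` whose `x`-coordinate is congruent to `i` modulo `m`. -/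
def ival (m i : ℤ) (P : List Step) : ℕ :=
  ((valleys P).filter fun j => (pt P (j + 1)).1 % m = i % m).card

/-- The set of returns of `P`: valleys of the form `(m·i, i)`. -/
def returns (m : ℤ) (P : List Step) : Finset ℕ :=
  (valleys P).filter fun j => (pt P (j + 1)).1 = m * (pt P (j + 1)).2

/-- The number of returns of `P`. -/
def ret (m : ℤ) (P : List Step) : ℕ := (returns m P).card

/-- The set of indices of diagonal steps of `P`. -/
def diags (P : List Step) : Finset ℕ :=
  (Finset.range P.length).filter fun j => P[j]? = some Step.D

/-- The number of diagonal steps of `P`. -/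
def dg (P : List Step) : ℕ := (diags P).card

/-- A Schröder path is `m`-divisible if every diagonal step ends at an `x`-coordinate
divisible by `m`. -/
def MDivisible (m : ℤ) (P : List Step) : Prop :=
  ∀ j ∈ diags P, m ∣ (pt P (j + 1)).1

/-- The number of cornered diagonal steps of `P`: diagonal steps connecting `(i·m − 1, i)`
to `(i·m, i + 1)` for some `i`. -/
def cd (m : ℤ) (P : List Step) : ℕ :=
  ((diags P).filter fun j => (pt P (j + 1)).1 = m * ((pt P (j + 1)).2 - 1)).card

/-- The generalized binomial coefficient `C(p,q) = p(p−1)⋯(p−q+1)/q!` for integers `p` and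
`q ≥ 0`, and `C(p,q) = 0` for `q < 0`. -/
def C (p q : ℤ) : ℤ :=
  if q < 0 then 0
  else if 0 ≤ p then (p.toNat.choose q.toNat : ℤ)
  else (-1) ^ q.toNat * ((q - p - 1).toNat.choose q.toNat : ℤ)

/-- The path `P`, started at `p`, is strictly above the line `x = m·y` except possibly at its
endpoint. -/
def StrictFrom (m : ℤ) (p : ℤ × ℤ) (P : List Step) : Prop :=
  ∀ k < P.length, (p + pt P k).1 < m * (p + pt P k).2

/-- Every diagonal step of the path `P`, started at `p`, ends at an `x`-coordinate divisible
by `m`. -/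
def MDivisibleFrom (m : ℤ) (p : ℤ × ℤ) (P : List Step) : Prop :=
  ∀ j ∈ diags P, m ∣ (p + pt P (j + 1)).1

/-- The number of cornered diagonal steps of the path `P` started at `p`. -/
def cdFrom (m : ℤ) (p : ℤ × ℤ) (P : List Step) : ℕ :=
  ((diags P).filter fun j => (p + pt P (j + 1)).1 = m * ((p + pt P (j + 1)).2 - 1)).card

theorem pt_zero (P : List Step) : pt P 0 = 0 := by simp [pt]

theorem pt_cons_succ (s : Step) (P : List Step) (k : ℕ) :
    pt (s :: P) (k + 1) = stepVec s + pt P k := by simp [pt]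

theorem pt_length (P : List Step) :
    pt P P.length = ((P.count .E + P.count .D : ℤ), (P.count .N + P.count .D : ℤ)) := by
  induction P with
  | nil => simp [pt, Prod.zero_eq_mk]
  | cons s P ih =>
    rw [List.length_cons, pt_cons_succ, ih]
    cases s <;> simp [stepVec, add_comm, add_left_comm, add_assoc]

theorem diags_cons (s : Step) (P : List Step) :
    diags (s :: P) = (if s = .D then {0} else ∅) ∪ (diags P).map (addRightEmbedding 1) := by
  ext j
  rcases j with _ | j
  · by_cases h : s = .D <;> simp [diags, h]
  · by_cases h : s = .D <;> simp [diags, h]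

theorem forall_mem_diags_cons (s : Step) (P : List Step) (q : ℕ → Prop) :
    (∀ j ∈ diags (s :: P), q j) ↔ (s = .D → q 0) ∧ ∀ j ∈ diags P, q (j + 1) := by
  by_cases h : s = .D <;> simp [diags_cons, h]

theorem card_filter_diags_cons (s : Step) (P : List Step) (q : ℕ → Prop) [DecidablePred q] :
    ((diags (s :: P)).filter q).card =
      (if s = .D ∧ q 0 then 1 else 0) + ((diags P).filter fun j => q (j + 1)).card := by
  have hd : Disjoint (((if s = .D then {0} else ∅ : Finset ℕ)).filter q)
      (((diags P).map (addRightEmbedding 1)).filter q) := by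
    rw [Finset.disjoint_left]
    intro j hj hj'
    simp only [Finset.mem_filter, Finset.mem_map, addRightEmbedding_apply] at hj hj'
    obtain ⟨⟨i, -, rfl⟩, -⟩ := hj'
    split_ifs at hj <;> simp at hj
  rw [diags_cons, Finset.filter_union, Finset.card_union_of_disjoint hd, Finset.filter_map,
    Finset.card_map]
  congr 1
  by_cases h : s = .D <;> by_cases h' : q 0 <;> simp [h, h', Finset.filter_singleton]

theorem dg_eq_count (P : List Step) : dg P = P.count .D := by
  induction P with
  | nil => simp [dg, diags]
  | cons s P ih =>
    have := card_filter_diags_cons s P (fun _ => True)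
    simp only [Finset.filter_true, and_true] at this
    rw [dg, this, ← dg, ih, List.count_cons, add_comm]
    simp

theorem cdFrom_le_count (m : ℤ) (p : ℤ × ℤ) (P : List Step) : cdFrom m p P ≤ P.count .D := by
  rw [← dg_eq_count]
  exact Finset.card_filter_le _ _

theorem strictFrom_cons (m : ℤ) (p : ℤ × ℤ) (s : Step) (P : List Step) :
    StrictFrom m p (s :: P) ↔ p.1 < m * p.2 ∧ StrictFrom m (p + stepVec s) P := by
  constructor
  · intro h
    refine ⟨by simpa [pt_zero] using h 0 (by simp), fun k hk => ?_⟩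
    simpa only [pt_cons_succ, add_assoc] using h (k + 1) (by simpa using hk)
  · rintro ⟨h0, h⟩ (_ | k) hk
    · simpa [pt_zero] using h0
    · simpa only [pt_cons_succ, add_assoc] using h k (by simpa using hk)

theorem mDivisibleFrom_cons (m : ℤ) (p : ℤ × ℤ) (s : Step) (P : List Step) :
    MDivisibleFrom m p (s :: P) ↔
      (s = .D → m ∣ p.1 + 1) ∧ MDivisibleFrom m (p + stepVec s) P := by
  rw [MDivisibleFrom, forall_mem_diags_cons]
  refine and_congr (forall_congr' ?_) ?_
  · rintro rfl
    simp [pt_cons_succ, pt_zero, stepVec]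
  · simp only [MDivisibleFrom, pt_cons_succ, add_assoc p]

theorem cdFrom_cons (m : ℤ) (p : ℤ × ℤ) (s : Step) (P : List Step) :
    cdFrom m p (s :: P) =
      (if s = .D ∧ p.1 + 1 = m * p.2 then 1 else 0) + cdFrom m (p + stepVec s) P := by
  rw [cdFrom, card_filter_diags_cons]
  congr 1
  · congr 1
    rw [eq_iff_iff]
    refine and_congr_right ?_
    rintro rfl
    simp [pt_cons_succ, pt_zero, stepVec]
  · simp only [cdFrom, pt_cons_succ, add_assoc p]

/-- Final segments of `m`-divisible positive paths which still have to make `e` unit moves to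
the east, `s` north steps, `c` diagonal steps that are not cornered and `b` cornered ones. -/
def IsTail (m : ℕ) : List Step → ℕ → ℕ → ℕ → ℕ → Prop
  | [], e, s, c, b => e = 0 ∧ s = 0 ∧ c = 0 ∧ b = 0
  | .N :: P, e, s, c, b => m * (s + c + b) < e ∧ ∃ s', s = s' + 1 ∧ IsTail m P e s' c b
  | .E :: P, e, s, c, b => m * (s + c + b) < e ∧ ∃ e', e = e' + 1 ∧ IsTail m P e' s c b
  | .D :: P, e, s, c, b => m * (s + c + b) < e ∧ ∃ e', e = e' + 1 ∧ m ∣ e' ∧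
      ((e' = m * (s + c + b) ∧ ∃ b', b = b' + 1 ∧ IsTail m P e' s c b') ∨
        (e' ≠ m * (s + c + b) ∧ ∃ c', c = c' + 1 ∧ IsTail m P e' s c' b))

theorem isTail_iff (m n : ℕ) (P : List Step) (e s c b : ℕ) (p : ℤ × ℤ)
    (h1 : p.1 = m * n - e) (h2 : p.2 = n - (s + c + b)) :
    IsTail m P e s c b ↔ P.count .N = s ∧ P.count .E + P.count .D = e ∧ P.count .D = c + b ∧
      StrictFrom m p P ∧ MDivisibleFrom m p P ∧ cdFrom m p P = b := by
  induction P generalizing e s c b p with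
  | nil =>
    simp only [IsTail, StrictFrom, MDivisibleFrom, cdFrom, diags]
    simp
    omega
  | cons x P ih =>
    have hlt : p.1 < m * p.2 ↔ m * (s + c + b) < e := by
      rw [h1, h2, mul_sub, sub_lt_sub_iff_left]
      norm_cast
    rw [strictFrom_cons, mDivisibleFrom_cons, cdFrom_cons, hlt]
    cases x with
    | N =>
      simp only [IsTail, List.count_cons, reduceCtorEq, false_and, if_false, false_imp_iff,
        true_and, beq_self_eq_true, if_true, zero_add, beq_iff_eq, add_zero]
      constructor
      · rintro ⟨h, s', rfl, H⟩
        rw [ih e s' c b (p + stepVec .N) (by simp [stepVec, h1])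
          (by simp [stepVec, h2]; ring)] at H
        tauto
      · rintro ⟨rfl, hE, hD, ⟨h, hS⟩, hM, hc⟩
        refine ⟨h, _, rfl, ?_⟩
        rw [ih e _ c b (p + stepVec .N) (by simp [stepVec, h1])
          (by simp [stepVec, h2]; ring)]
        tauto
    | E =>
      simp only [IsTail, List.count_cons, reduceCtorEq, false_and, if_false, false_imp_iff,
        true_and, beq_self_eq_true, if_true, zero_add, beq_iff_eq, add_zero]
      constructor
      · rintro ⟨h, e', rfl, H⟩
        rw [ih e' s c b (p + stepVec .E) (by simp [stepVec, h1]; ring)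
          (by simp [stepVec, h2])] at H
        obtain ⟨hN, hE, hD, hS, hM, hc⟩ := H
        exact ⟨hN, by omega, hD, ⟨h, hS⟩, hM, hc⟩
      · rintro ⟨hN, hE, hD, ⟨h, hS⟩, hM, hc⟩
        obtain ⟨e', rfl⟩ : ∃ e', e = e' + 1 := ⟨e - 1, by omega⟩
        refine ⟨h, e', rfl, ?_⟩
        rw [ih e' s c b (p + stepVec .E) (by simp [stepVec, h1]; ring)
          (by simp [stepVec, h2])]
        exact ⟨hN, by omega, hD, hS, hM, hc⟩
    | D =>
      have hdvd (e' : ℕ) (he : e = e' + 1) : (m : ℤ) ∣ p.1 + 1 ↔ m ∣ e' := by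
        rw [h1, he, Nat.cast_add, Nat.cast_one,
          show (m * n - (e' + 1) + 1 : ℤ) = m * n - e' by ring, dvd_sub_right (dvd_mul_right _ _),
          Int.natCast_dvd_natCast]
      have hcor (e' : ℕ) (he : e = e' + 1) :
          p.1 + 1 = m * p.2 ↔ e' = m * (s + c + b) := by
        rw [h1, h2, he, mul_sub, Nat.cast_add, Nat.cast_one,
          show (m * n - (e' + 1) + 1 : ℤ) = m * n - e' by ring, sub_right_inj]
        norm_cast
      simp only [IsTail, List.count_cons, reduceCtorEq, if_false, forall_const,
        true_and, beq_self_eq_true, if_true, beq_iff_eq, add_zero]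
      constructor
      · rintro ⟨h, e', rfl, hd, ⟨hc', b', rfl, H⟩ | ⟨hc', c', rfl, H⟩⟩
        · rw [ih e' s c b' (p + stepVec .D) (by simp [stepVec, h1]; ring)
            (by simp [stepVec, h2]; ring)] at H
          obtain ⟨hN, hE, hD, hS, hM, hc⟩ := H
          rw [hdvd e' rfl, if_pos ((hcor e' rfl).2 hc')]
          exact ⟨hN, by omega, by omega, ⟨h, hS⟩, ⟨hd, hM⟩, by omega⟩
        · rw [ih e' s c' b (p + stepVec .D) (by simp [stepVec, h1]; ring)
            (by simp [stepVec, h2]; ring)] at H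
          obtain ⟨hN, hE, hD, hS, hM, hc⟩ := H
          rw [hdvd e' rfl, if_neg (mt (hcor e' rfl).1 hc')]
          exact ⟨hN, by omega, by omega, ⟨h, hS⟩, ⟨hd, hM⟩, by omega⟩
      · rintro ⟨hN, hE, hD, ⟨h, hS⟩, ⟨hd, hM⟩, hc⟩
        obtain ⟨e', rfl⟩ : ∃ e', e = e' + 1 := ⟨e - 1, by omega⟩
        rw [hdvd e' rfl] at hd
        have hle := cdFrom_le_count m (p + stepVec .D) P
        refine ⟨h, e', rfl, hd, ?_⟩
        by_cases hc' : e' = m * (s + c + b)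
        · rw [if_pos ((hcor e' rfl).2 hc')] at hc
          obtain ⟨b', rfl⟩ : ∃ b', b = b' + 1 := ⟨b - 1, by omega⟩
          refine Or.inl ⟨hc', b', rfl, ?_⟩
          rw [ih e' s c b' (p + stepVec .D) (by simp [stepVec, h1]; ring)
            (by simp [stepVec, h2]; ring)]
          exact ⟨hN, by omega, by omega, hS, hM, by omega⟩
        · rw [if_neg (mt (hcor e' rfl).1 hc')] at hc
          obtain ⟨c', rfl⟩ : ∃ c', c = c' + 1 := ⟨c - 1, by omega⟩
          refine Or.inr ⟨hc', c', rfl, ?_⟩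
          rw [ih e' s c' b (p + stepVec .D) (by simp [stepVec, h1]; ring)
            (by simp [stepVec, h2]; ring)]
          exact ⟨hN, by omega, by omega, hS, hM, by omega⟩

theorem finite_and_ncard_of_cons {X : Set (List Step)} (h0 : [] ∉ X)
    (hN : {P | Step.N :: P ∈ X}.Finite) (hE : {P | Step.E :: P ∈ X}.Finite)
    (hD : {P | Step.D :: P ∈ X}.Finite) :
    X.Finite ∧ X.ncard = {P | Step.N :: P ∈ X}.ncard + {P | Step.E :: P ∈ X}.ncard
      + {P | Step.D :: P ∈ X}.ncard := by
  have hX : X = (List.cons Step.N '' {P | Step.N :: P ∈ X} ∪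
      List.cons Step.E '' {P | Step.E :: P ∈ X}) ∪
      List.cons Step.D '' {P | Step.D :: P ∈ X} := by
    ext P
    rcases P with _ | ⟨_ | _ | _, P⟩ <;> simp [h0]
  have hN' := hN.image (List.cons Step.N)
  have hE' := hE.image (List.cons Step.E)
  have hD' := hD.image (List.cons Step.D)
  refine ⟨hX ▸ (hN'.union hE').union hD', ?_⟩
  conv_lhs => rw [hX]
  rw [Set.ncard_union_eq ?_ (hN'.union hE') hD', Set.ncard_union_eq ?_ hN' hE',
    Set.ncard_image_of_injective _ List.cons_injective,
    Set.ncard_image_of_injective _ List.cons_injective,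
    Set.ncard_image_of_injective _ List.cons_injective]
  · rw [Set.disjoint_left]
    rintro _ ⟨P, -, rfl⟩ ⟨Q, -, h⟩
    simp at h
  · rw [Set.disjoint_left]
    rintro _ (⟨P, -, rfl⟩ | ⟨P, -, rfl⟩) ⟨Q, -, h⟩ <;> simp at h

/-- The number of multisets of size `s - 1` on `e + 1` letters, which is `0` for `s = 0`. -/
def predMultichoose (e : ℕ) : ℕ → ℕ
  | 0 => 0
  | s + 1 => Nat.multichoose (e + 1) s

theorem predMultichoose_succ_succ (e s : ℕ) :
    predMultichoose (e + 1) (s + 1) = predMultichoose e (s + 1) + predMultichoose (e + 1) s := by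
  cases s with
  | zero => simp [predMultichoose]
  | succ s => exact Nat.multichoose_succ_succ _ _

theorem mul_multichoose_eq (e s : ℕ) :
    s * Nat.multichoose e s = e * predMultichoose e s := by
  cases s with
  | zero => simp [predMultichoose]
  | succ s =>
    cases e with
    | zero => simp
    | succ e =>
      have h := Nat.choose_succ_right_eq (e + 1 + s) s
      rw [predMultichoose, Nat.multichoose_eq, Nat.multichoose_eq,
        show e + 1 + (s + 1) - 1 = e + 1 + s by omega,
        show e + 1 + 1 + s - 1 = e + 1 + s by omega, mul_comm, h, mul_comm]
      congr 1
      omega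

/-- The closed form for the number of final segments with `q < ⌈e / m⌉ ≤ q + 1`. -/
def tailCount (m q e s c b : ℕ) : ℤ :=
  (q - b - 1).choose c * Nat.multichoose e s - m * ((q - b).choose c * predMultichoose e s)

theorem tailCount_zero_zero (m e b : ℕ) : tailCount m 0 e 0 0 b = 1 := by
  simp [tailCount, predMultichoose]

theorem tailCount_succ_zero (m q e c b : ℕ) :
    tailCount m q (e + 1) 0 c b = tailCount m q e 0 c b := by
  simp [tailCount, predMultichoose]

theorem tailCount_succ_succ (m q e s c b : ℕ) :
    tailCount m q (e + 1) (s + 1) c b =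
      tailCount m q (e + 1) s c b + tailCount m q e (s + 1) c b := by
  simp only [tailCount, predMultichoose_succ_succ, Nat.multichoose_succ_succ]
  push_cast
  ring

theorem tailCount_pascal (m q e s c b : ℕ) (h : b + 1 < q) :
    tailCount m q e s (c + 1) b =
      tailCount m (q - 1) e s (c + 1) b + tailCount m (q - 1) e s c b := by
  obtain ⟨j, rfl⟩ : ∃ j, q = b + j + 2 := ⟨q - b - 2, by omega⟩
  rw [tailCount, tailCount, tailCount, show b + j + 2 - b - 1 = j + 1 by omega,
    show b + j + 2 - b = j + 1 + 1 by omega, show b + j + 2 - 1 - b - 1 = j by omega,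
    show b + j + 2 - 1 - b = j + 1 by omega, Nat.choose_succ_succ' (j + 1),
    Nat.choose_succ_succ' j]
  push_cast
  ring

theorem tailCount_boundary (m s c : ℕ) (h : 0 < s + c) :
    tailCount m (s + c) (m * (s + c)) s c 0 = 0 := by
  obtain ⟨q, hq⟩ : ∃ q, s + c = q + 1 := ⟨s + c - 1, by omega⟩
  have h1 : (q + 1) * q.choose c = (q + 1).choose c * s := by
    have := Nat.choose_mul_succ_eq q c
    rw [mul_comm, this]
    congr 1
    omega
  have h2 := mul_multichoose_eq (m * (q + 1)) s
  rw [tailCount, hq]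
  simp only [Nat.sub_zero, Nat.add_sub_cancel]
  rw [sub_eq_zero]
  norm_cast
  refine Nat.eq_of_mul_eq_mul_left q.succ_pos ?_
  rw [Nat.succ_eq_add_one, ← mul_assoc, h1, mul_assoc, h2]
  ring

theorem tailCount_pred (m q e s b : ℕ) :
    tailCount m q e s 0 b = tailCount m (q - 1) e s 0 b := by
  simp [tailCount]

theorem tailCount_cornered (m q e s c b : ℕ) :
    tailCount m q e s c (b + 1) = tailCount m (q - 1) e s c b := by
  rw [tailCount, tailCount, show q - (b + 1) = q - 1 - b by omega]

theorem not_isTail_of_le {m e s c b : ℕ} (P : List Step) (he : 0 < e)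
    (h : e ≤ m * (s + c + b)) : ¬ IsTail m P e s c b := by
  rcases P with _ | ⟨_ | _ | _, P⟩ <;> simp only [IsTail] <;> omega

theorem isTail_zero_iff (m s c b : ℕ) (P : List Step) :
    IsTail m P 0 s c b ↔ P = [] ∧ s = 0 ∧ c = 0 ∧ b = 0 := by
  rcases P with _ | ⟨_ | _ | _, P⟩ <;> simp [IsTail]

theorem finite_and_ncard_isTail_east_or_diag (m : ℕ) (e s c b q : ℕ)
    (ih : ∀ s c b q : ℕ, m * q < e → e ≤ m * q + m → s + c + b ≤ q →
      {P | IsTail m P e s c b}.Finite ∧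
        ({P | IsTail m P e s c b}.ncard : ℤ) = tailCount m q e s c b)
    (h1 : m * q < e + 1) (h2 : e + 1 ≤ m * q + m) (h3 : s + c + b ≤ q) :
    ({P | IsTail m (.E :: P) (e + 1) s c b}.Finite ∧
      {P | IsTail m (.D :: P) (e + 1) s c b}.Finite) ∧
      ({P | IsTail m (.E :: P) (e + 1) s c b}.ncard : ℤ) +
        {P | IsTail m (.D :: P) (e + 1) s c b}.ncard = tailCount m q e s c b := by
  have hlt : m * (s + c + b) < e + 1 := (Nat.mul_le_mul_left m h3).trans_lt h1
  have hE : {P | IsTail m (.E :: P) (e + 1) s c b} = {P | IsTail m P e s c b} := by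
    ext P
    simp [IsTail, hlt]
  rw [hE]
  have hm : 0 < m := by
    rcases Nat.eq_zero_or_pos m with rfl | h
    · simp at h2
    · exact h
  rcases (Nat.lt_succ_iff.1 h1).lt_or_eq with hq | rfl
  · have hd : ¬ m ∣ e := by
      rintro ⟨k, rfl⟩
      have hk := lt_of_mul_lt_mul_left hq (Nat.zero_le m)
      have := Nat.mul_le_mul_left m (Nat.succ_le_of_lt hk)
      rw [Nat.mul_succ] at this
      omega
    have hD : {P | IsTail m (.D :: P) (e + 1) s c b} = ∅ := by
      ext P
      simp [IsTail, hd]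
    obtain ⟨hf, hcard⟩ := ih s c b q hq (by omega) h3
    simp [hD, hf, hcard]
  rcases Nat.eq_zero_or_pos q with rfl | hq
  · obtain ⟨rfl, rfl, rfl⟩ : s = 0 ∧ c = 0 ∧ b = 0 := by omega
    have hD : {P | IsTail m (.D :: P) (m * 0 + 1) 0 0 0} = ∅ := by
      ext P
      simp [IsTail]
    have hnil : {P | IsTail m P (m * 0) 0 0 0} = {[]} := by
      ext P
      simp [isTail_zero_iff]
    rw [hnil, hD, tailCount_zero_zero]
    simp
  have hpred : m * (q - 1) + m = m * q := by
    rw [← Nat.mul_succ, Nat.succ_eq_add_one, Nat.sub_add_cancel hq]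
  have hpos : 0 < m * q := Nat.mul_pos hm hq
  rcases h3.lt_or_eq with h3 | rfl
  · have hne : m * q ≠ m * (s + c + b) := fun h => h3.ne' (Nat.eq_of_mul_eq_mul_left hm h)
    obtain ⟨hf, hcard⟩ := ih s c b (q - 1) (by omega) (by omega) (by omega)
    cases c with
    | zero =>
      have hD : {P | IsTail m (.D :: P) (m * q + 1) s 0 b} = ∅ := by
        ext P
        simp only [IsTail, Set.mem_ofPred_eq, Set.mem_empty_iff_false, iff_false]
        rintro ⟨-, e', he, -, ⟨h, -⟩ | ⟨-, c', h, -⟩⟩ <;> omega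
      simp [hD, hf, hcard, ← tailCount_pred]
    | succ c =>
      have hD : {P | IsTail m (.D :: P) (m * q + 1) s (c + 1) b} =
          {P | IsTail m P (m * q) s c b} := by
        ext P
        simp [IsTail, hlt, hne]
      obtain ⟨hf', hcard'⟩ := ih s c b (q - 1) (by omega) (by omega) (by omega)
      rw [hD, hcard, hcard', tailCount_pascal m q _ _ _ _ (by omega)]
      exact ⟨⟨hf, hf'⟩, rfl⟩
  · have hempty : {P | IsTail m P (m * (s + c + b)) s c b} = ∅ :=
      Set.eq_empty_of_forall_notMem fun P => not_isTail_of_le P hpos le_rfl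
    cases b with
    | zero =>
      have hD : {P | IsTail m (.D :: P) (m * (s + c + 0) + 1) s c 0} = ∅ := by
        ext P
        simp [IsTail]
      rw [hempty, hD]
      simp [tailCount_boundary m s c hq]
    | succ b =>
      have hD : {P | IsTail m (.D :: P) (m * (s + c + (b + 1)) + 1) s c (b + 1)} =
          {P | IsTail m P (m * (s + c + (b + 1))) s c b} := by
        ext P
        simp [IsTail]
      obtain ⟨hf, hcard⟩ :=
        ih s c b (s + c + (b + 1) - 1) (by omega) (by omega) (by omega)
      rw [hempty, hD, hcard, tailCount_cornered]
      simp [hf]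

theorem finite_and_ncard_isTail (m e s c b q : ℕ) (h1 : m * q < e)
    (h2 : e ≤ m * q + m) (h3 : s + c + b ≤ q) :
    {P | IsTail m P e s c b}.Finite ∧
      ({P | IsTail m P e s c b}.ncard : ℤ) = tailCount m q e s c b := by
  induction e generalizing s c b q with
  | zero => omega
  | succ e ihe =>
    induction s with
    | zero =>
      have hN : {P | IsTail m (.N :: P) (e + 1) 0 c b} = ∅ := by
        simp [IsTail]
      obtain ⟨⟨hE, hD⟩, hED⟩ :=
        finite_and_ncard_isTail_east_or_diag m e 0 c b q ihe h1 h2 h3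
      obtain ⟨hf, hcard⟩ := finite_and_ncard_of_cons (X := {P | IsTail m P (e + 1) 0 c b})
        (by simp [IsTail]) (by simp [hN]) hE hD
      refine ⟨hf, ?_⟩
      rw [hcard, tailCount_succ_zero, ← hED]
      simp [hN]
    | succ s ihs =>
      obtain ⟨⟨hE, hD⟩, hED⟩ :=
        finite_and_ncard_isTail_east_or_diag m e (s + 1) c b q ihe h1 h2 h3
      obtain ⟨hNf, hNcard⟩ := ihs (by omega)
      have hlt : m * (s + 1 + c + b) < e + 1 := (Nat.mul_le_mul_left m h3).trans_lt h1
      have hN : {P | IsTail m (.N :: P) (e + 1) (s + 1) c b} =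
          {P | IsTail m P (e + 1) s c b} := by
        ext P
        simp [IsTail, hlt]
      obtain ⟨hf, hcard⟩ := finite_and_ncard_of_cons
        (X := {P | IsTail m P (e + 1) (s + 1) c b})
        (by simp [IsTail]) (by simpa only [Set.mem_ofPred_eq, hN] using hNf) hE hD
      refine ⟨hf, ?_⟩
      simp only [Set.mem_ofPred_eq] at hcard
      rw [hcard, hN, tailCount_succ_succ, ← hED, ← hNcard]
      push_cast
      ring

theorem mDivisibleFrom_replicate_append (m : ℤ) (t : ℕ) (p : ℤ × ℤ) (P : List Step) :
    MDivisibleFrom m p (List.replicate t .N ++ P) ↔ MDivisibleFrom m (p + (0, (t : ℤ))) P := by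
  induction t generalizing p with
  | zero => simp [Prod.mk_zero_zero]
  | succ t ih =>
    rw [List.replicate_succ, List.cons_append, mDivisibleFrom_cons, ih, add_assoc]
    simp [stepVec, add_comm]

theorem cdFrom_replicate_append (m : ℤ) (t : ℕ) (p : ℤ × ℤ) (P : List Step) :
    cdFrom m p (List.replicate t .N ++ P) = cdFrom m (p + (0, (t : ℤ))) P := by
  induction t generalizing p with
  | zero => simp [Prod.mk_zero_zero]
  | succ t ih =>
    rw [List.replicate_succ, List.cons_append, cdFrom_cons, ih, add_assoc]
    simp [stepVec, add_comm]

theorem pt_of_length_le {P : List Step} {k : ℕ} (h : P.length ≤ k) :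
    pt P k = pt P P.length := by
  simp [pt, List.take_of_length_le h]

theorem pt_replicate_append_of_le {t k : ℕ} (h : k ≤ t) (P : List Step) :
    pt (List.replicate t .N ++ P) k = (0, (k : ℤ)) := by
  induction k generalizing t with
  | zero => simp [pt_zero, Prod.zero_eq_mk]
  | succ k ih =>
    obtain ⟨t, rfl⟩ : ∃ t', t = t' + 1 := ⟨t - 1, by omega⟩
    rw [List.replicate_succ, List.cons_append, pt_cons_succ, ih (by omega)]
    simp [stepVec, add_comm]

theorem pt_replicate_append_add (t k : ℕ) (P : List Step) :
    pt (List.replicate t .N ++ P) (t + k) = (0, (t : ℤ)) + pt P k := by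
  induction t with
  | zero => simp [Prod.mk_zero_zero]
  | succ t ih =>
    rw [List.replicate_succ, List.cons_append, show t + 1 + k = t + k + 1 by omega,
      pt_cons_succ, ih, ← add_assoc]
    simp [stepVec, add_comm]

theorem aboveLine_and_isPositive_iff (m n : ℤ) (hm : 0 < m) (t : ℕ) (ht : 0 < t)
    (P : List Step)
    (h : pt (List.replicate t .N ++ P) (List.replicate t Step.N ++ P).length = (m * n, n)) :
    AboveLine m (List.replicate t .N ++ P) ∧ IsPositive m (List.replicate t .N ++ P) ↔
      StrictFrom m (0, (t : ℤ)) P := by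
  constructor
  · rintro ⟨hA, hP⟩ k hk
    have h1 := hA (t + k)
    have h2 := hP (t + k) (by omega) (by simpa using hk)
    rw [pt_replicate_append_add] at h1 h2
    exact lt_of_le_of_ne h1 h2
  · intro hS
    have key (k : ℕ) (h0 : 0 < k) (hk : k < (List.replicate t Step.N ++ P).length) :
        (pt (List.replicate t .N ++ P) k).1 < m * (pt (List.replicate t .N ++ P) k).2 := by
      rcases le_total k t with hkt | hkt
      · rw [pt_replicate_append_of_le hkt]
        exact mul_pos hm (Int.natCast_pos.2 h0)
      · obtain ⟨k, rfl⟩ := Nat.exists_eq_add_of_le hkt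
        rw [pt_replicate_append_add]
        exact hS k (by simpa using hk)
    refine ⟨fun k => ?_, fun k h0 hk => (key k h0 hk).ne⟩
    rcases Nat.eq_zero_or_pos k with rfl | h0
    · simp [pt_zero]
    rcases lt_or_ge k (List.replicate t Step.N ++ P).length with hk | hk
    · exact (key k h0 hk).le
    · rw [pt_of_length_le hk, h]

theorem mDivisible_iff (m : ℤ) (P : List Step) : MDivisible m P ↔ MDivisibleFrom m 0 P := by
  simp [MDivisible, MDivisibleFrom]

theorem cd_eq (m : ℤ) (P : List Step) : cd m P = cdFrom m 0 P := by
  simp [cd, cdFrom]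

theorem setOf_isSchroeder_eq_image (m s c b t : ℕ) (hm : 0 < m) (ht : 0 < t) :
    {S : List Step | IsSchroeder m (s + c + b + t : ℕ) t S ∧ IsPositive m S ∧ MDivisible m S ∧
        (dg S : ℤ) = (c + b : ℕ) ∧ (cd m S : ℤ) = b} =
      (List.replicate t .N ++ ·) '' {P | IsTail m P (m * (s + c + b + t)) s c b} := by
  ext S
  have tail_iff (P : List Step) := isTail_iff m (s + c + b + t) P (m * (s + c + b + t)) s c b
    (0, (t : ℤ)) (by simp) (by push_cast; ring)
  have len (P : List Step) :
      pt (List.replicate t .N ++ P) (List.replicate t Step.N ++ P).length =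
        ((m : ℤ) * (s + c + b + t : ℕ), ((s + c + b + t : ℕ) : ℤ)) ↔
      P.count .E + P.count .D = m * (s + c + b + t) ∧
        P.count .N + P.count .D = s + c + b := by
    rw [pt_length, Prod.mk.injEq]
    simp only [List.count_append, List.count_replicate]
    simp
    norm_cast
    omega
  have hd (P : List Step) : dg (List.replicate t .N ++ P) = P.count .D := by
    rw [dg_eq_count, List.count_append, List.count_replicate]
    simp
  simp only [Set.mem_ofPred_eq, Set.mem_image, IsSchroeder, StartsNorth, Int.toNat_natCast,
    Nat.cast_inj]
  constructor
  · rintro ⟨⟨⟨P, rfl⟩, hl, hA⟩, hP, hM, hdg, hcd⟩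
    have hS := (aboveLine_and_isPositive_iff m _ (by exact_mod_cast hm) t ht P hl).1 ⟨hA, hP⟩
    rw [len] at hl
    rw [mDivisible_iff, mDivisibleFrom_replicate_append, zero_add] at hM
    rw [cd_eq, cdFrom_replicate_append, zero_add] at hcd
    rw [hd] at hdg
    exact ⟨P, (tail_iff P).2 ⟨by omega, hl.1, hdg, hS, hM, hcd⟩, rfl⟩
  · rintro ⟨P, hP, rfl⟩
    obtain ⟨hN, hE, hD, hS, hM, hcd⟩ := (tail_iff P).1 hP
    have hl := (len P).2 ⟨hE, by omega⟩
    obtain ⟨hA, hP⟩ :=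
      (aboveLine_and_isPositive_iff m _ (by exact_mod_cast hm) t ht P hl).2 hS
    rw [mDivisible_iff, mDivisibleFrom_replicate_append, zero_add, cd_eq,
      cdFrom_replicate_append, zero_add, hd]
    exact ⟨⟨⟨P, rfl⟩, hl, hA⟩, hP, hM, hD, hcd⟩

theorem C_natCast (p q : ℕ) : C p q = p.choose q := by
  simp [C]

theorem tailCount_eq (m s c b t : ℕ) (h : 0 < s + c + t - 1) :
    (tailCount m (s + c + b + t - 1) (m * (s + c + b + t)) s c b : ℚ) =
      ((t + c + b : ℚ) / (s + c + b + t) - c / (s + c + t - 1)) *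
        (s + c + t - 1).choose c * Nat.multichoose (m * (s + c + b + t)) s := by
  obtain ⟨j, hj⟩ : ∃ j, s + c + t = j + 2 := ⟨s + c + t - 2, by omega⟩
  have hjq : (s + c + t - 1 : ℚ) = j + 1 := by
    have : (s + c + t : ℚ) = j + 2 := by exact_mod_cast hj
    linarith
  have hpos : (0 : ℚ) < s + c + b + t := by
    exact_mod_cast (show 0 < s + c + b + t by omega)
  have h1 : ((j.choose c : ℕ) : ℚ) * (j + 1) = (j + 1).choose c * (j + 1 - c) := by
    have := Nat.choose_mul_succ_eq j c
    have hc : c ≤ j + 1 ∨ j + 1 < c := le_or_gt _ _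
    rcases hc with hc | hc
    · rw [← Nat.cast_inj (R := ℚ)] at this
      push_cast [hc] at this
      exact this
    · rw [Nat.choose_eq_zero_of_lt hc, Nat.choose_eq_zero_of_lt (by omega)]
      simp
  have h2 : (s : ℚ) * Nat.multichoose (m * (s + c + b + t)) s =
      m * (s + c + b + t) * predMultichoose (m * (s + c + b + t)) s := by
    exact_mod_cast mul_multichoose_eq (m * (s + c + b + t)) s
  rw [tailCount, show s + c + b + t - 1 - b - 1 = j by omega,
    show s + c + b + t - 1 - b = j + 1 by omega, show s + c + t - 1 = j + 1 by omega, hjq]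
  have hj0 : (j + 1 : ℚ) ≠ 0 := by positivity
  have h1' : ((j.choose c : ℕ) : ℚ) = (j + 1).choose c * (1 - c / (j + 1)) := by
    field_simp
    exact h1
  have h2' : (m : ℚ) * predMultichoose (m * (s + c + b + t)) s =
      s / (s + c + b + t) * Nat.multichoose (m * (s + c + b + t)) s := by
    field_simp
    linarith
  have h3 : (t + c + b : ℚ) / (s + c + b + t) = 1 - s / (s + c + b + t) := by
    field_simp
    ring
  push_cast
  rw [h1', h3, mul_left_comm, h2']
  ring

/-- the number of `m`-divisible positive `(m,t)`-Schröder paths of height `n`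
with `a` diagonal steps and `b` cornered diagonal steps. -/
theorem statement9 (m n t a b : ℤ) (hm : 0 < m) (hn : 0 < n) (ht : 0 < t)
    (hb : 0 ≤ b) (hba : b ≤ a) (ha : a ≤ n - t) (hne : n - b - 1 ≠ 0) :
    (({S : List Step | IsSchroeder m n t S ∧ IsPositive m S ∧ MDivisible m S ∧
        (dg S : ℤ) = a ∧ (cd m S : ℤ) = b}.ncard : ℚ))
      = (((t + a : ℤ) : ℚ) / ((n : ℤ) : ℚ)
          - ((a - b : ℤ) : ℚ) / ((n - b - 1 : ℤ) : ℚ))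
        * ((C (n - b - 1) (a - b) : ℤ) : ℚ)
        * ((C (m * n + n - t - a - 1) (n - t - a) : ℤ) : ℚ) := by
  lift m to ℕ using hm.le
  lift t to ℕ using ht.le
  lift b to ℕ using hb
  obtain ⟨c, rfl⟩ := Int.le.dest hba
  obtain ⟨s, hs⟩ := Int.le.dest ha
  obtain rfl : n = (s + c + b + t : ℕ) := by
    push_cast
    linarith
  have hm' : 0 < m := by exact_mod_cast hm
  have ht' : 0 < t := by exact_mod_cast ht
  have hpos : 0 < s + c + t - 1 := by omega
  have hset := setOf_isSchroeder_eq_image m s c b t hm' ht'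
  have hcount := (finite_and_ncard_isTail m (m * (s + c + b + t)) s c b (s + c + b + t - 1)
    (Nat.mul_lt_mul_of_pos_left (by omega) hm')
    (by rw [← Nat.mul_succ]; exact Nat.mul_le_mul_left m (by omega)) (by omega)).2
  have hC1 : ((s + c + b + t : ℕ) : ℤ) - b - 1 = (s + c + t - 1 : ℕ) := by omega
  have hC2 : (m : ℤ) * (s + c + b + t : ℕ) + (s + c + b + t : ℕ) - t - (b + c) - 1 =
      (m * (s + c + b + t) + s - 1 : ℕ) := by
    have : 0 < m * (s + c + b + t) := Nat.mul_pos hm' (by omega)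
    rw [Nat.cast_sub (by omega)]
    push_cast
    ring
  have hC3 : ((s + c + b + t : ℕ) : ℤ) - t - (b + c) = s := by
    push_cast
    ring
  rw [show (b + c : ℤ) = (c + b : ℕ) by push_cast; ring, hset,
    Set.ncard_image_of_injective _ (List.append_right_injective _)]
  rw [show ((c + b : ℕ) : ℤ) = b + c by push_cast; ring, hC2, hC3, add_sub_cancel_left, hC1,
    C_natCast, C_natCast, ← Nat.multichoose_eq, ← Int.cast_natCast (Set.ncard _), hcount,
    tailCount_eq m s c b t hpos]
  have hcast : ((s + c + t - 1 : ℕ) : ℚ) = s + c + t - 1 := by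
    rw [Nat.cast_sub (by omega)]
    push_cast
    ring
  push_cast [hcast]
  ring
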